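/- For each r ∈ {1, 2, 4}, every pseudo H-type Lie algebra n_{r,r} built on a minimal admissible Cl_{r,r}-module admits a Lie algebra automorphism φ mapping the center ℝ^{2r} onto itself whose restriction to the center is an anti-isometry of the scalar product ⟨·,·⟩_{r,r}. -/

import Mathlib

/-- The standard scalar product of signature `(r,s)` on `ℝ^(r+s)`:
`⟨Z,W⟩_{r,s} = ∑_{i<r} Z i * W i - ∑_{r ≤ i < r+s} Z i * W i`. -/
def sform (r s : ℕ) (Z W : Fin (r + s) → ℝ) : ℝ :=
  ∑ i : Fin (r + s), (if (i : ℕ) < r then (1 : ℝ) else -1) * Z i * W i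

/-- `(V, B, J)` is an admissible module of the Clifford algebra `Cl_{r,s}`:
`V` is a nonzero finite-dimensional real vector space, `B` a nondegenerate
symmetric bilinear form on `V`, and `J : ℝ^{r+s} → End V` linear with
`J_Z ∘ J_Z = -⟨Z,Z⟩_{r,s} • id` and each `J_Z` skew-adjoint w.r.t. `B`. -/
def IsAdmissible (r s : ℕ) (V : Type) [AddCommGroup V] [Module ℝ V]
    (B : V →ₗ[ℝ] V →ₗ[ℝ] ℝ)
    (J : (Fin (r + s) → ℝ) →ₗ[ℝ] V →ₗ[ℝ] V) : Prop :=
  FiniteDimensional ℝ V ∧ Nontrivial V ∧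
  (∀ v w : V, B v w = B w v) ∧
  (∀ v : V, (∀ w : V, B v w = 0) → v = 0) ∧
  (∀ (Z : Fin (r + s) → ℝ) (v : V), J Z (J Z v) = (-(sform r s Z Z)) • v) ∧
  (∀ (Z : Fin (r + s) → ℝ) (v w : V), B (J Z v) w = -(B v (J Z w)))

/-- A minimal admissible `Cl_{r,s}`-module: one of least possible dimension. -/
def IsMinimalAdmissible (r s : ℕ) (V : Type) [AddCommGroup V] [Module ℝ V]
    (B : V →ₗ[ℝ] V →ₗ[ℝ] ℝ)
    (J : (Fin (r + s) → ℝ) →ₗ[ℝ] V →ₗ[ℝ] V) : Prop :=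
  IsAdmissible r s V B J ∧
  ∀ (V' : Type) [AddCommGroup V'] [Module ℝ V']
    (B' : V' →ₗ[ℝ] V' →ₗ[ℝ] ℝ)
    (J' : (Fin (r + s) → ℝ) →ₗ[ℝ] V' →ₗ[ℝ] V'),
    IsAdmissible r s V' B' J' → Module.finrank ℝ V ≤ Module.finrank ℝ V'

/-- `br` is the Lie bracket of the pseudo `H`-type Lie algebra `V ⊕ ℝ^{r+s}`
determined by the admissible module `(V,B,J)`, i.e.
`⟨Z, [v,w]⟩_{r,s} = ⟨J_Z v, w⟩_V` for all `Z, v, w`. -/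
def IsHBracket (r s : ℕ) (V : Type) [AddCommGroup V] [Module ℝ V]
    (B : V →ₗ[ℝ] V →ₗ[ℝ] ℝ)
    (J : (Fin (r + s) → ℝ) →ₗ[ℝ] V →ₗ[ℝ] V)
    (br : V →ₗ[ℝ] V →ₗ[ℝ] (Fin (r + s) → ℝ)) : Prop :=
  ∀ (Z : Fin (r + s) → ℝ) (v w : V), sform r s Z (br v w) = B (J Z v) w

/-- A linear equivalence `f` between the pseudo `H`-type Lie algebras
`V₁ ⊕ ℝ^{n₁}` and `V₂ ⊕ ℝ^{n₂}` (with 2-step brackets `br₁`, `br₂`, the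
`ℝ^{nᵢ}` factors being central) is a Lie algebra isomorphism. -/
def IsLieIso {V₁ : Type} [AddCommGroup V₁] [Module ℝ V₁]
    {V₂ : Type} [AddCommGroup V₂] [Module ℝ V₂] {n₁ n₂ : ℕ}
    (br₁ : V₁ →ₗ[ℝ] V₁ →ₗ[ℝ] (Fin n₁ → ℝ))
    (br₂ : V₂ →ₗ[ℝ] V₂ →ₗ[ℝ] (Fin n₂ → ℝ))
    (f : (V₁ × (Fin n₁ → ℝ)) ≃ₗ[ℝ] (V₂ × (Fin n₂ → ℝ))) : Prop :=
  ∀ x y : V₁ × (Fin n₁ → ℝ),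
    f (0, br₁ x.1 y.1) = (0, br₂ (f x).1 (f y).1)

section ControlledSign

variable {R : Type*} [Ring R] [Algebra ℝ R]

/-- For commuting involutions `x` and `y`, the involution which is `-1` on the common
`-1`-eigenspace of `x` and `y` and `1` on the other common eigenspaces. -/
noncomputable def controlledSign (x y : R) : R := (1 / 2 : ℝ) • (1 + x + y - x * y)

theorem controlledSign_comm {x y : R} (h : Commute x y) :
    controlledSign x y = controlledSign y x := by
  simp only [controlledSign, h.eq, add_right_comm]

theorem Commute.controlledSign_right {g x y : R} (hx : Commute g x) (hy : Commute g y) :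
    Commute g (controlledSign x y) :=
  ((((Commute.one_right g).add_right hx).add_right hy).sub_right (hx.mul_right hy)).smul_right _

theorem mul_controlledSign_of_anticomm {g x y : R} (hx : g * x = -(x * g)) (hy : Commute g y) :
    g * controlledSign x y = controlledSign (-x) y * g := by
  have h : g * (x * y) = -(x * y * g) := by
    rw [← mul_assoc, hx, neg_mul, mul_assoc, hy.eq, mul_assoc]
  simp only [controlledSign, mul_smul_comm, smul_mul_assoc, mul_add, mul_sub, add_mul, sub_mul,
    hx, hy.eq, h, mul_one, one_mul, neg_mul]

theorem controlledSign_mul_neg_right {x y : R} (hx : x * x = 1) (hy : y * y = 1)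
    (h : Commute x y) : controlledSign x y * controlledSign x (-y) = x := by
  have e : y * x = x * y := h.eq.symm
  have e' (t : R) : y * (x * t) = x * (y * t) := by rw [← mul_assoc, e, mul_assoc]
  have f (t : R) : x * (x * t) = t := by rw [← mul_assoc, hx, one_mul]
  simp only [controlledSign, mul_smul_comm, smul_mul_assoc, mul_add, mul_sub, add_mul, sub_mul,
    mul_one, one_mul, mul_neg, mul_assoc, e, e', f, hx, hy]
  module

theorem controlledSign_neg_mul {x y : R} (hx : x * x = 1) (hy : y * y = 1)
    (h : Commute x y) : controlledSign (-x) (-y) * controlledSign x y = -(x * y) := by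
  have e : y * x = x * y := h.eq.symm
  have e' (t : R) : y * (x * t) = x * (y * t) := by rw [← mul_assoc, e, mul_assoc]
  have f (t : R) : x * (x * t) = t := by rw [← mul_assoc, hx, one_mul]
  simp only [controlledSign, mul_smul_comm, smul_mul_assoc, mul_add, mul_sub, add_mul, sub_mul,
    mul_one, one_mul, mul_neg, neg_mul, mul_assoc, e, e', f, hx, hy]
  module

theorem controlledSign_neg_mul_mul {g x y : R} (hx : x * x = 1) (hy : y * y = 1)
    (h : Commute x y) (gx : g * x = -(x * g)) (gy : Commute g y) :
    controlledSign (-x) (-y) * g * controlledSign x y = -(x * g) := by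
  have e := controlledSign_mul_neg_right (x := -x) (y := -y) (by simpa) (by simpa)
    h.neg_left.neg_right
  rw [neg_neg] at e
  rw [mul_assoc, mul_controlledSign_of_anticomm gx gy, ← mul_assoc, e, neg_mul]

/-- The product of the controlled signs of all pairs among four commuting involutions. -/
noncomputable def controlledSign₄ (x y z w : R) : R :=
  controlledSign x y * controlledSign z w * controlledSign (x * y) (z * w)

/-- The image of `controlledSign₄ x y z w` under an anti-involution negating `x`, `y`, `z`, `w`. -/
noncomputable def controlledSign₄Adj (x y z w : R) : R :=
  controlledSign (x * y) (z * w) * (controlledSign (-z) (-w) * controlledSign (-x) (-y))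

theorem controlledSign₄_swap_left {x y : R} (h : Commute x y) (z w : R) :
    controlledSign₄ x y z w = controlledSign₄ y x z w := by
  simp only [controlledSign₄, controlledSign_comm h, h.eq]

theorem controlledSign₄Adj_swap_left {x y : R} (h : Commute x y) (z w : R) :
    controlledSign₄Adj x y z w = controlledSign₄Adj y x z w := by
  simp only [controlledSign₄Adj, controlledSign_comm h.neg_left.neg_right, h.eq]

theorem controlledSign₄_swap_pairs {x y z w : R} (xz : Commute x z) (xw : Commute x w)
    (yz : Commute y z) (yw : Commute y w) :
    controlledSign₄ x y z w = controlledSign₄ z w x y := by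
  have h : Commute (controlledSign x y) (controlledSign z w) :=
    (xz.symm.controlledSign_right yz.symm).symm.controlledSign_right
      (xw.symm.controlledSign_right yw.symm).symm
  rw [controlledSign₄, controlledSign₄, h.eq,
    controlledSign_comm ((xz.mul_right xw).mul_left (yz.mul_right yw))]

theorem controlledSign₄Adj_swap_pairs {x y z w : R} (xz : Commute x z) (xw : Commute x w)
    (yz : Commute y z) (yw : Commute y w) :
    controlledSign₄Adj x y z w = controlledSign₄Adj z w x y := by
  have h : Commute (controlledSign (-x) (-y)) (controlledSign (-z) (-w)) :=
    (xz.symm.neg_right.controlledSign_right yz.symm.neg_right).symm.neg_right.controlledSign_right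
      (xw.symm.neg_right.controlledSign_right yw.symm.neg_right).symm.neg_right
  rw [controlledSign₄Adj, controlledSign₄Adj, h.eq,
    controlledSign_comm ((xz.mul_right xw).mul_left (yz.mul_right yw))]

theorem controlledSign₄Adj_mul_mul {g x y z w : R} (hx : x * x = 1) (hy : y * y = 1)
    (hz : z * z = 1) (hw : w * w = 1) (xy : Commute x y) (xz : Commute x z) (xw : Commute x w)
    (yz : Commute y z) (yw : Commute y w) (zw : Commute z w)
    (gx : g * x = -(x * g)) (gy : Commute g y) (gz : Commute g z) (gw : Commute g w) :
    controlledSign₄Adj x y z w * g * controlledSign₄ x y z w = x * g := by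
  have hxy : x * y * (x * y) = 1 := by rw [xy.symm.mul_mul_mul_comm, hx, hy, one_mul]
  have hzw : z * w * (z * w) = 1 := by rw [zw.symm.mul_mul_mul_comm, hz, hw, one_mul]
  have gxy : g * (x * y) = -(x * y * g) := by
    rw [← mul_assoc, gx, neg_mul, mul_assoc, gy.eq, mul_assoc]
  have comm : Commute (x * y) (z * w) := (xz.mul_right xw).mul_left (yz.mul_right yw)
  set k := controlledSign (x * y) (z * w) with hk
  set c := controlledSign z w with hc
  have xgc : Commute (x * g) c :=
    (xz.controlledSign_right xw).mul_left (gz.controlledSign_right gw)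
  have kzwx : Commute (z * w * x) k :=
    ((comm.symm.controlledSign_right (Commute.refl _))).mul_left
      (((Commute.refl x).mul_right xy).controlledSign_right (xz.mul_right xw))
  have kk : k * controlledSign (-(x * y)) (z * w) = z * w := by
    rw [hk, controlledSign_comm comm, controlledSign_comm comm.neg_left]
    exact controlledSign_mul_neg_right hzw hxy comm.symm
  calc controlledSign₄Adj x y z w * g * controlledSign₄ x y z w
      = k * (controlledSign (-z) (-w) *
          (controlledSign (-x) (-y) * g * controlledSign x y) * c * k) := by
        simp only [controlledSign₄Adj, controlledSign₄, mul_assoc, hk, hc]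
    _ = k * (-(controlledSign (-z) (-w) * c) * (x * g) * k) := by
        rw [controlledSign_neg_mul_mul hx hy xy gx gy]
        simp only [mul_neg, neg_mul, mul_assoc, ← xgc.eq]
    _ = k * (z * w * x) * (g * k) := by
        rw [hc, controlledSign_neg_mul hz hw zw, neg_neg]
        simp only [mul_assoc]
    _ = z * w * x * (k * controlledSign (-(x * y)) (z * w)) * g := by
        rw [← kzwx.eq, hk, mul_controlledSign_of_anticomm gxy (gz.mul_right gw)]
        simp only [mul_assoc]
    _ = x * g := by
        rw [kk, mul_assoc (z * w) x, (xz.mul_right xw).eq, ← mul_assoc, hzw, one_mul]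

end ControlledSign

section ScalarProduct

variable {r : ℕ}

theorem sform_eq_sub (r s : ℕ) (Z W : Fin (r + s) → ℝ) :
    sform r s Z W = ∑ i : Fin r, Z (Fin.castAdd s i) * W (Fin.castAdd s i) -
      ∑ i : Fin s, Z (Fin.natAdd r i) * W (Fin.natAdd r i) := by
  simp [sform, Fin.sum_univ_add, sub_eq_add_neg]

theorem sform_smul_left (r s : ℕ) (a : ℝ) (Z W : Fin (r + s) → ℝ) :
    sform r s (a • Z) W = a * sform r s Z W := by
  simp only [sform, Finset.mul_sum, Pi.smul_apply, smul_eq_mul]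
  exact Finset.sum_congr rfl fun i _ => by ring

theorem sform_smul_right (r s : ℕ) (a : ℝ) (Z W : Fin (r + s) → ℝ) :
    sform r s Z (a • W) = a * sform r s Z W := by
  simp only [sform, Finset.mul_sum, Pi.smul_apply, smul_eq_mul]
  exact Finset.sum_congr rfl fun i _ => by ring

theorem sform_add_left (r s : ℕ) (Z Z' W : Fin (r + s) → ℝ) :
    sform r s (Z + Z') W = sform r s Z W + sform r s Z' W := by
  simp only [sform, ← Finset.sum_add_distrib, Pi.add_apply]
  exact Finset.sum_congr rfl fun i _ => by ring

theorem sform_comm (r s : ℕ) (Z W : Fin (r + s) → ℝ) : sform r s Z W = sform r s W Z :=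
  Finset.sum_congr rfl fun i _ => by ring

theorem sform_single_left (r s : ℕ) (i : Fin (r + s)) (W : Fin (r + s) → ℝ) :
    sform r s (Pi.single i 1) W = (if (i : ℕ) < r then 1 else -1) * W i := by
  rw [sform, Finset.sum_eq_single i (by simp +contextual) (by simp), Pi.single_eq_same, mul_one]

theorem eq_of_forall_sform_eq {r s : ℕ} {W W' : Fin (r + s) → ℝ}
    (h : ∀ Z, sform r s Z W = sform r s Z W') : W = W' := by
  funext i
  have := h (Pi.single i 1)
  rw [sform_single_left, sform_single_left] at this
  split_ifs at this <;> simpa using this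

/-- The exchange of the positive and the negative standard coordinates of `ℝ^(r+r)`. -/
def coordSwap (r : ℕ) : (Fin (r + r) → ℝ) ≃ₗ[ℝ] (Fin (r + r) → ℝ) :=
  LinearEquiv.funCongrLeft ℝ ℝ finAddFlip

theorem coordSwap_castAdd (Z : Fin (r + r) → ℝ) (i : Fin r) :
    coordSwap r Z (Fin.castAdd r i) = Z (Fin.natAdd r i) :=
  congrArg Z (finAddFlip_apply_castAdd i r)

theorem coordSwap_natAdd (Z : Fin (r + r) → ℝ) (i : Fin r) :
    coordSwap r Z (Fin.natAdd r i) = Z (Fin.castAdd r i) :=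
  congrArg Z (finAddFlip_apply_natAdd i r)

theorem sform_coordSwap (Z W : Fin (r + r) → ℝ) :
    sform r r (coordSwap r Z) (coordSwap r W) = -sform r r Z W := by
  simp only [sform_eq_sub, coordSwap_castAdd, coordSwap_natAdd]
  ring

theorem sform_coordSwap_left (Z W : Fin (r + r) → ℝ) :
    sform r r (coordSwap r Z) W = -sform r r Z (coordSwap r W) := by
  simp only [sform_eq_sub, coordSwap_castAdd, coordSwap_natAdd]
  ring

end ScalarProduct

section AdmissibleModule

variable {r s : ℕ} {V : Type} [AddCommGroup V] [Module ℝ V]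

/-- The Clifford generator attached to the `i`-th positive basis vector. -/
def posGen (J : (Fin (r + s) → ℝ) →ₗ[ℝ] V →ₗ[ℝ] V) (i : Fin r) : Module.End ℝ V :=
  J (Pi.single (Fin.castAdd s i) 1)

/-- The Clifford generator attached to the `i`-th negative basis vector. -/
def negGen (J : (Fin (r + s) → ℝ) →ₗ[ℝ] V →ₗ[ℝ] V) (i : Fin s) : Module.End ℝ V :=
  J (Pi.single (Fin.natAdd r i) 1)

theorem map_eq_sum_posGen_add_sum_negGen (J : (Fin (r + s) → ℝ) →ₗ[ℝ] V →ₗ[ℝ] V)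
    (Z : Fin (r + s) → ℝ) :
    J Z = ∑ i, Z (Fin.castAdd s i) • posGen J i + ∑ i, Z (Fin.natAdd r i) • negGen J i := by
  conv_lhs => rw [pi_eq_sum_univ' Z, map_sum, Fin.sum_univ_add]
  simp only [map_smul, posGen, negGen]

variable {B : V →ₗ[ℝ] V →ₗ[ℝ] ℝ} {J : (Fin (r + s) → ℝ) →ₗ[ℝ] V →ₗ[ℝ] V}

/-- Clifford multiplications by orthogonal vectors anticommute. -/
theorem IsAdmissible.mul_eq_neg_mul (h : IsAdmissible r s V B J) {Z W : Fin (r + s) → ℝ}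
    (hZW : sform r s Z W = 0) :
    (J Z * J W : Module.End ℝ V) = -(J W * J Z) := by
  obtain ⟨-, -, -, -, hJ, -⟩ := h
  ext v
  have e := hJ (Z + W) v
  have hs : sform r s (Z + W) (Z + W) = sform r s Z Z + sform r s W W := by
    rw [sform_add_left, sform_comm r s Z, sform_comm r s W, sform_add_left, sform_add_left,
      hZW, sform_comm r s W Z, hZW]
    ring
  simp only [map_add, LinearMap.add_apply, hJ, hs] at e
  simp only [Module.End.mul_apply, LinearMap.neg_apply]
  rw [neg_add, add_smul] at e
  refine eq_neg_of_add_eq_zero_left ?_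
  rw [← sub_eq_zero.2 e]
  module

theorem IsAdmissible.mul_self (h : IsAdmissible r s V B J) (Z : Fin (r + s) → ℝ) :
    (J Z * J Z : Module.End ℝ V) = -(sform r s Z Z) • 1 := by
  ext v
  exact h.2.2.2.2.1 Z v

theorem IsAdmissible.posGen_mul_self (h : IsAdmissible r s V B J) (i : Fin r) :
    posGen J i * posGen J i = -1 := by
  rw [posGen, h.mul_self]
  simp [sform_single_left]

theorem IsAdmissible.negGen_mul_self (h : IsAdmissible r s V B J) (i : Fin s) :
    negGen J i * negGen J i = 1 := by
  rw [negGen, h.mul_self]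
  simp [sform_single_left]

theorem IsAdmissible.posGen_mul_posGen (h : IsAdmissible r s V B J) {i j : Fin r} (hij : i ≠ j) :
    posGen J i * posGen J j = -(posGen J j * posGen J i) :=
  h.mul_eq_neg_mul (by simp [sform_single_left, hij])

theorem IsAdmissible.negGen_mul_negGen (h : IsAdmissible r s V B J) {i j : Fin s} (hij : i ≠ j) :
    negGen J i * negGen J j = -(negGen J j * negGen J i) :=
  h.mul_eq_neg_mul (by simp [sform_single_left, hij])

theorem IsAdmissible.posGen_mul_negGen (h : IsAdmissible r s V B J) (i : Fin r) (j : Fin s) :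
    posGen J i * negGen J j = -(negGen J j * posGen J i) :=
  h.mul_eq_neg_mul (by simp [sform_single_left, Pi.single_apply, Fin.ext_iff]; omega)

theorem IsAdmissible.posGen_skew (h : IsAdmissible r s V B J) (i : Fin r) (v w : V) :
    B (posGen J i v) w = -B v (posGen J i w) :=
  h.2.2.2.2.2 _ v w

theorem IsAdmissible.negGen_skew (h : IsAdmissible r s V B J) (i : Fin s) (v w : V) :
    B (negGen J i v) w = -B v (negGen J i w) :=
  h.2.2.2.2.2 _ v w

end AdmissibleModule

section SwappedGenerators

variable {r : ℕ} {V : Type} [AddCommGroup V] [Module ℝ V]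
  {B : V →ₗ[ℝ] V →ₗ[ℝ] ℝ} {J : (Fin (r + r) → ℝ) →ₗ[ℝ] V →ₗ[ℝ] V}
  {br : V →ₗ[ℝ] V →ₗ[ℝ] (Fin (r + r) → ℝ)}

/-- An endomorphism of an admissible module that exchanges, up to a common sign, the forms
`B (J_Z v) w` of the positive and the negative generators gives an automorphism of the
Lie algebra acting on the center by an anti-isometry. -/
theorem exists_antiisometric_automorphism (hr : r ≠ 0) (h : IsAdmissible r r V B J)
    (hbr : IsHBracket r r V B J br) (A : Module.End ℝ V) {ε : ℝ} (hε : ε * ε = 1)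
    (hpos : ∀ i v w, B (posGen J i (A v)) (A w) = ε * B (negGen J i v) w)
    (hneg : ∀ i v w, B (negGen J i (A v)) (A w) = ε * B (posGen J i v) w) :
    ∃ (φ : (V × (Fin (r + r) → ℝ)) ≃ₗ[ℝ] (V × (Fin (r + r) → ℝ)))
      (C : (Fin (r + r) → ℝ) →ₗ[ℝ] (Fin (r + r) → ℝ)),
      IsLieIso br br φ ∧
      (∀ Z : Fin (r + r) → ℝ, φ (0, Z) = (0, C Z)) ∧
      Function.Surjective ⇑C ∧
      (∀ Z W : Fin (r + r) → ℝ, sform r r (C Z) (C W) = -(sform r r Z W)) := by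
  have hA (Z v w) : B (J Z (A v)) (A w) = ε * B (J (coordSwap r Z) v) w := by
    rw [map_eq_sum_posGen_add_sum_negGen J Z, map_eq_sum_posGen_add_sum_negGen J (coordSwap r Z)]
    simp only [LinearMap.add_apply, LinearMap.sum_apply, LinearMap.smul_apply, map_add, map_sum,
      map_smul, hpos, hneg, coordSwap_castAdd, coordSwap_natAdd, smul_eq_mul, mul_add,
      Finset.mul_sum, mul_left_comm ε]
    exact add_comm _ _
  have hε0 : ε ≠ 0 := by rintro rfl; simp at hε
  have := h.1
  have inj : Function.Injective A := by
    refine (injective_iff_map_eq_zero A).2 fun v hv => ?_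
    obtain ⟨i⟩ : Nonempty (Fin r) := Fin.pos_iff_nonempty.1 (Nat.pos_of_ne_zero hr)
    have e : negGen J i v = 0 := h.2.2.2.1 _ fun w => by
      have := hpos i v w
      rw [hv, map_zero, map_zero, LinearMap.zero_apply] at this
      exact (mul_eq_zero.1 this.symm).resolve_left hε0
    have e' := LinearMap.congr_fun (h.negGen_mul_self i) v
    rwa [Module.End.mul_apply, e, map_zero, Module.End.one_apply, eq_comm] at e'
  let C : (Fin (r + r) → ℝ) ≃ₗ[ℝ] (Fin (r + r) → ℝ) :=
    (coordSwap r).trans (LinearEquiv.smulOfNeZero ℝ _ (-ε) (neg_ne_zero.2 hε0))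
  have hC (Z) : C Z = (-ε) • coordSwap r Z := rfl
  refine ⟨(LinearEquiv.ofInjectiveEndo A inj).prodCongr C, C, fun x y => ?_, fun Z => ?_,
    C.surjective, fun Z W => ?_⟩
  · refine Prod.ext (map_zero A) (eq_of_forall_sform_eq (r := r) (s := r) fun Z => ?_)
    change sform r r Z (C (br x.1 y.1)) = sform r r Z (br (A x.1) (A y.1))
    rw [hbr, hA, ← hbr, hC, sform_smul_right, sform_coordSwap_left]
    ring
  · exact Prod.ext (map_zero A) rfl
  · change sform r r (C Z) (C W) = _
    rw [hC, hC, sform_smul_left, sform_smul_right, sform_coordSwap]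
    linear_combination (-sform r r Z W) * hε

end SwappedGenerators

section PairedInvolutions

variable {r : ℕ} {V : Type} [AddCommGroup V] [Module ℝ V]
  {B : V →ₗ[ℝ] V →ₗ[ℝ] ℝ} {J : (Fin (r + r) → ℝ) →ₗ[ℝ] V →ₗ[ℝ] V}

theorem commute_mul_of_anticomm {R : Type*} [Ring R] {g x y : R} (hx : g * x = -(x * g))
    (hy : g * y = -(y * g)) : Commute g (x * y) := by
  rw [Commute, SemiconjBy, ← mul_assoc, hx, neg_mul, mul_assoc, hy, mul_neg, neg_neg, mul_assoc]

/-- The product of the `i`-th positive and the `i`-th negative generator. -/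
def genProd (J : (Fin (r + r) → ℝ) →ₗ[ℝ] V →ₗ[ℝ] V) (i : Fin r) : Module.End ℝ V :=
  posGen J i * negGen J i

theorem IsAdmissible.genProd_mul_posGen (h : IsAdmissible r r V B J) (i : Fin r) :
    genProd J i * posGen J i = negGen J i := by
  rw [genProd, h.posGen_mul_negGen, neg_mul, mul_assoc, h.posGen_mul_self, mul_neg, neg_neg,
    mul_one]

theorem IsAdmissible.genProd_mul_negGen (h : IsAdmissible r r V B J) (i : Fin r) :
    genProd J i * negGen J i = posGen J i := by
  rw [genProd, mul_assoc, h.negGen_mul_self, mul_one]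

theorem IsAdmissible.posGen_mul_genProd (h : IsAdmissible r r V B J) (i : Fin r) :
    posGen J i * genProd J i = -(genProd J i * posGen J i) := by
  rw [h.genProd_mul_posGen, genProd, ← mul_assoc, h.posGen_mul_self, neg_mul, one_mul]

theorem IsAdmissible.negGen_mul_genProd (h : IsAdmissible r r V B J) (i : Fin r) :
    negGen J i * genProd J i = -(genProd J i * negGen J i) := by
  rw [h.genProd_mul_negGen, genProd, h.posGen_mul_negGen, mul_neg, ← mul_assoc,
    h.negGen_mul_self, one_mul]

theorem IsAdmissible.genProd_mul_self (h : IsAdmissible r r V B J) (i : Fin r) :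
    genProd J i * genProd J i = 1 := by
  nth_rw 2 [genProd]
  rw [← mul_assoc, h.genProd_mul_posGen, h.negGen_mul_self]

theorem IsAdmissible.commute_posGen_genProd (h : IsAdmissible r r V B J) {i j : Fin r}
    (hij : i ≠ j) : Commute (posGen J i) (genProd J j) :=
  commute_mul_of_anticomm (h.posGen_mul_posGen hij) (h.posGen_mul_negGen i j)

theorem IsAdmissible.commute_negGen_genProd (h : IsAdmissible r r V B J) {i j : Fin r}
    (hij : i ≠ j) : Commute (negGen J i) (genProd J j) :=
  commute_mul_of_anticomm (by rw [h.posGen_mul_negGen, neg_neg]) (h.negGen_mul_negGen hij)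

theorem IsAdmissible.commute_genProd (h : IsAdmissible r r V B J) {i j : Fin r}
    (hij : i ≠ j) : Commute (genProd J i) (genProd J j) :=
  (h.commute_posGen_genProd hij).mul_left (h.commute_negGen_genProd hij)

theorem IsAdmissible.genProd_skew (h : IsAdmissible r r V B J) (i : Fin r) (v w : V) :
    B (genProd J i v) w = B v ((-genProd J i) w) := by
  rw [LinearMap.neg_apply, map_neg, genProd, Module.End.mul_apply, h.posGen_skew, h.negGen_skew,
    neg_neg, ← Module.End.mul_apply, ← neg_eq_iff_eq_neg.2 (h.posGen_mul_negGen i i)]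
  simp

theorem controlledSign_adjoint {x y x' y' : Module.End ℝ V}
    (hx : ∀ v w, B (x v) w = B v (x' w)) (hy : ∀ v w, B (y v) w = B v (y' w))
    (h : Commute x' y') (v w : V) :
    B (controlledSign x y v) w = B v (controlledSign x' y' w) := by
  simp only [controlledSign, LinearMap.smul_apply, LinearMap.sub_apply, LinearMap.add_apply,
    Module.End.mul_apply, Module.End.one_apply, map_smul, map_sub, map_add, hx, hy]
  rw [← Module.End.mul_apply y', ← h.eq, Module.End.mul_apply]

end PairedInvolutions

section RankTwo

variable {V : Type} [AddCommGroup V] [Module ℝ V]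
  {B : V →ₗ[ℝ] V →ₗ[ℝ] ℝ} {J : (Fin (2 + 2) → ℝ) →ₗ[ℝ] V →ₗ[ℝ] V}

theorem exists_exchange_two (h : IsAdmissible 2 2 V B J) :
    ∃ A : Module.End ℝ V,
      (∀ i v w, B (posGen J i (A v)) (A w) = -1 * B (negGen J i v) w) ∧
      (∀ i v w, B (negGen J i (A v)) (A w) = -1 * B (posGen J i v) w) := by
  have hc : Commute (genProd J 0) (genProd J 1) := h.commute_genProd (by decide)
  have adj (u w) : B u (controlledSign (genProd J 0) (genProd J 1) w) =
      B (controlledSign (-genProd J 0) (-genProd J 1) u) w :=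
    (controlledSign_adjoint (fun v w => by
      rw [LinearMap.neg_apply, map_neg, LinearMap.neg_apply, h.genProd_skew, LinearMap.neg_apply,
        map_neg, neg_neg]) (fun v w => by
      rw [LinearMap.neg_apply, map_neg, LinearMap.neg_apply, h.genProd_skew, LinearMap.neg_apply,
        map_neg, neg_neg]) hc u w).symm
  have key {i j : Fin 2} (hij : i ≠ j) {g : Module.End ℝ V}
      (gi : g * genProd J i = -(genProd J i * g)) (gj : Commute g (genProd J j)) (v w : V) :
      B (g (controlledSign (genProd J 0) (genProd J 1) v))
        (controlledSign (genProd J 0) (genProd J 1) w) = -1 * B ((genProd J i * g) v) w := by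
    have e := controlledSign_neg_mul_mul (h.genProd_mul_self i) (h.genProd_mul_self j)
      (h.commute_genProd hij) gi gj
    have e' : controlledSign (-genProd J 0) (-genProd J 1) * g *
        controlledSign (genProd J 0) (genProd J 1) = -(genProd J i * g) := by
      fin_cases i <;> fin_cases j
      · exact absurd rfl hij
      · exact e
      · rwa [controlledSign_comm hc, controlledSign_comm hc.neg_left.neg_right]
      · exact absurd rfl hij
    rw [adj, ← Module.End.mul_apply, ← Module.End.mul_apply, e']
    simp
  have other (i : Fin 2) : ∃ j, i ≠ j := (exists_ne i).imp fun _ h => h.symm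
  refine ⟨controlledSign (genProd J 0) (genProd J 1), fun i v w => ?_, fun i v w => ?_⟩ <;>
    obtain ⟨j, hij⟩ := other i
  · rw [key hij (h.posGen_mul_genProd i) (h.commute_posGen_genProd hij), h.genProd_mul_posGen]
  · rw [key hij (h.negGen_mul_genProd i) (h.commute_negGen_genProd hij), h.genProd_mul_negGen]

end RankTwo

section RankFour

variable {V : Type} [AddCommGroup V] [Module ℝ V]
  {B : V →ₗ[ℝ] V →ₗ[ℝ] ℝ} {J : (Fin (4 + 4) → ℝ) →ₗ[ℝ] V →ₗ[ℝ] V}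

theorem exists_exchange_four (h : IsAdmissible 4 4 V B J) :
    ∃ A : Module.End ℝ V,
      (∀ i v w, B (posGen J i (A v)) (A w) = 1 * B (negGen J i v) w) ∧
      (∀ i v w, B (negGen J i (A v)) (A w) = 1 * B (posGen J i v) w) := by
  set P := genProd J with hP
  have hc {i j : Fin 4} (hij : i ≠ j) : Commute (P i) (P j) := h.commute_genProd hij
  have skew (i v w) : B ((-P i) v) w = B v (P i w) := by
    rw [LinearMap.neg_apply, map_neg, LinearMap.neg_apply, h.genProd_skew, LinearMap.neg_apply,
      map_neg, neg_neg]
  have sym {i j : Fin 4} (hij : i ≠ j) (v w) : B ((P i * P j) v) w = B v ((P i * P j) w) := by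
    rw [Module.End.mul_apply, h.genProd_skew, h.genProd_skew, ← Module.End.mul_apply, neg_mul_neg,
      (hc hij).eq]
  have adj (u w) : B u (controlledSign₄ (P 0) (P 1) (P 2) (P 3) w) =
      B (controlledSign₄Adj (P 0) (P 1) (P 2) (P 3) u) w := by
    simp only [controlledSign₄, controlledSign₄Adj, Module.End.mul_apply]
    rw [controlledSign_adjoint (sym (by decide)) (sym (by decide)),
      controlledSign_adjoint (skew 2) (skew 3) (hc (by decide)),
      controlledSign_adjoint (skew 0) (skew 1) (hc (by decide))]
    exact ((hc (by decide)).mul_right (hc (by decide))).mul_left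
      ((hc (by decide)).mul_right (hc (by decide)))
  have key (i : Fin 4) {g : Module.End ℝ V} (gi : g * P i = -(P i * g))
      (gj : ∀ j, i ≠ j → Commute g (P j)) (v w : V) :
      B (g (controlledSign₄ (P 0) (P 1) (P 2) (P 3) v))
        (controlledSign₄ (P 0) (P 1) (P 2) (P 3) w) = 1 * B ((P i * g) v) w := by
    have e {j k l : Fin 4} (ij : i ≠ j) (ik : i ≠ k) (il : i ≠ l) (jk : j ≠ k) (jl : j ≠ l)
        (kl : k ≠ l) :=
      controlledSign₄Adj_mul_mul (h.genProd_mul_self i) (h.genProd_mul_self j)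
        (h.genProd_mul_self k) (h.genProd_mul_self l) (hc ij) (hc ik) (hc il) (hc jk) (hc jl)
        (hc kl) gi (gj j ij) (gj k ik) (gj l il)
    have hpairs := controlledSign₄_swap_pairs (x := P 0) (y := P 1) (z := P 2) (w := P 3)
      (hc (by decide)) (hc (by decide)) (hc (by decide)) (hc (by decide))
    have hpairs' := controlledSign₄Adj_swap_pairs (x := P 0) (y := P 1) (z := P 2) (w := P 3)
      (hc (by decide)) (hc (by decide)) (hc (by decide)) (hc (by decide))
    have e' : controlledSign₄Adj (P 0) (P 1) (P 2) (P 3) * g *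
        controlledSign₄ (P 0) (P 1) (P 2) (P 3) = P i * g := by
      fin_cases i
      · exact e (by decide) (by decide) (by decide) (by decide) (by decide) (by decide)
      · rw [controlledSign₄_swap_left (hc (by decide)),
          controlledSign₄Adj_swap_left (hc (by decide))]
        exact e (by decide) (by decide) (by decide) (by decide) (by decide) (by decide)
      · rw [hpairs, hpairs']
        exact e (by decide) (by decide) (by decide) (by decide) (by decide) (by decide)
      · rw [hpairs, hpairs', controlledSign₄_swap_left (hc (by decide)),
          controlledSign₄Adj_swap_left (hc (by decide))]
        exact e (by decide) (by decide) (by decide) (by decide) (by decide) (by decide)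
    rw [adj, ← Module.End.mul_apply, ← Module.End.mul_apply, e', one_mul]
  refine ⟨controlledSign₄ (P 0) (P 1) (P 2) (P 3), fun i v w => ?_, fun i v w => ?_⟩
  · rw [key i (h.posGen_mul_genProd i) (fun j hij => h.commute_posGen_genProd hij), hP,
      h.genProd_mul_posGen]
  · rw [key i (h.negGen_mul_genProd i) (fun j hij => h.commute_negGen_genProd hij), hP,
      h.genProd_mul_negGen]

end RankFour

section RankOne

/-- A four-dimensional `Cl_{1,1}`-module structure on `ℝ⁴`. -/
def modelAction : (Fin (1 + 1) → ℝ) →ₗ[ℝ] (Fin 4 → ℝ) →ₗ[ℝ] (Fin 4 → ℝ) :=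
  LinearMap.mk₂ ℝ
    (fun Z x => Z 0 • ![-x 2, -x 3, x 0, x 1] + Z 1 • ![-x 2, -x 3, -x 0, -x 1])
    (fun Z Z' x => by simp only [Pi.add_apply]; module)
    (fun c Z x => by simp only [Pi.smul_apply, smul_eq_mul]; module)
    (fun Z x y => by ext i; fin_cases i <;> simp <;> ring)
    (fun c Z x => by ext i; fin_cases i <;> simp <;> ring)

/-- A neutral scalar product on `ℝ⁴` for which `modelAction` is admissible. -/
def modelForm : (Fin 4 → ℝ) →ₗ[ℝ] (Fin 4 → ℝ) →ₗ[ℝ] ℝ :=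
  LinearMap.mk₂ ℝ (fun x y => x 2 * y 1 + x 1 * y 2 - x 3 * y 0 - x 0 * y 3)
    (fun x x' y => by simp only [Pi.add_apply]; ring)
    (fun c x y => by simp only [Pi.smul_apply, smul_eq_mul]; ring)
    (fun x y y' => by simp only [Pi.add_apply]; ring)
    (fun c x y => by simp only [Pi.smul_apply, smul_eq_mul]; ring)

theorem isAdmissible_model : IsAdmissible 1 1 (Fin 4 → ℝ) modelForm modelAction := by
  refine ⟨inferInstance, inferInstance, fun v w => ?_, fun v hv => ?_, fun Z v => ?_,
    fun Z v w => ?_⟩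
  · simp only [modelForm, LinearMap.mk₂_apply]
    ring
  · have h (i : Fin 4) := hv (Pi.single i 1)
    ext i
    have h0 := h 0
    have h1 := h 1
    have h2 := h 2
    have h3 := h 3
    simp [modelForm] at h0 h1 h2 h3
    fin_cases i <;> simpa
  · ext i
    fin_cases i <;> simp [modelAction, sform] <;> ring
  · simp [modelAction, modelForm]
    ring

variable {V : Type} [AddCommGroup V] [Module ℝ V]
  {B : V →ₗ[ℝ] V →ₗ[ℝ] ℝ} {J : (Fin (1 + 1) → ℝ) →ₗ[ℝ] V →ₗ[ℝ] V}

theorem IsAdmissible.exists_normalized_pair (h : IsAdmissible 1 1 V B J) :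
    ∃ v w, genProd J 0 v = v ∧ genProd J 0 w = w ∧ B (posGen J 0 v) w = 1 := by
  have sq (x) : genProd J 0 (genProd J 0 x) = x := LinearMap.congr_fun (h.genProd_mul_self 0) x
  have anti (x) : posGen J 0 (genProd J 0 x) = -genProd J 0 (posGen J 0 x) :=
    LinearMap.congr_fun (h.posGen_mul_genProd 0) x
  have pos_sq (x) : posGen J 0 (posGen J 0 x) = -x :=
    LinearMap.congr_fun (h.posGen_mul_self 0) x
  have fixed (x) : genProd J 0 (x + genProd J 0 x) = x + genProd J 0 x := by
    rw [map_add, sq, add_comm]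
  have pos_ne {x} (hx : x ≠ 0) : posGen J 0 x ≠ 0 := fun e => hx <| by
    rw [← neg_eq_zero, ← pos_sq, e, map_zero]
  obtain ⟨v, hv0, hv⟩ : ∃ v, v ≠ 0 ∧ genProd J 0 v = v := by
    by_contra! H
    have hneg (x) : genProd J 0 x = -x := by
      by_contra hx
      exact H _ (fun e => hx (eq_neg_of_add_eq_zero_right e)) (fixed x)
    have := h.2.1
    obtain ⟨x, hx⟩ := exists_ne (0 : V)
    have e := anti x
    rw [hneg, hneg, map_neg, neg_neg] at e
    have e₂ : (2 : ℝ) • posGen J 0 x = 0 := by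
      rw [two_smul]
      nth_rw 1 [← e]
      exact neg_add_cancel _
    exact pos_ne hx ((smul_eq_zero.1 e₂).resolve_left two_ne_zero)
  obtain ⟨u, hu⟩ : ∃ u, B (posGen J 0 v) u ≠ 0 := by
    by_contra! H
    exact pos_ne hv0 (h.2.2.2.1 _ H)
  have e : B (posGen J 0 v) (u + genProd J 0 u) = 2 * B (posGen J 0 v) u := by
    have := h.genProd_skew 0 (posGen J 0 v) u
    rw [← neg_eq_iff_eq_neg.2 (anti v), hv] at this
    simp only [LinearMap.neg_apply, map_neg] at this
    rw [map_add]
    linarith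
  refine ⟨v, (2 * B (posGen J 0 v) u)⁻¹ • (u + genProd J 0 u), hv, ?_, ?_⟩
  · rw [map_smul, fixed]
  · rw [map_smul, e, smul_eq_mul, inv_mul_cancel₀ (mul_ne_zero two_ne_zero hu)]

theorem exists_exchange_one (h : IsAdmissible 1 1 V B J) (hdim : Module.finrank ℝ V ≤ 4) :
    ∃ A : Module.End ℝ V,
      (∀ i v w, B (posGen J i (A v)) (A w) = 1 * B (negGen J i v) w) ∧
      (∀ i v w, B (negGen J i (A v)) (A w) = 1 * B (posGen J i v) w) := by
  obtain ⟨v, w, hv, hw, hvw⟩ := h.exists_normalized_pair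
  set e := posGen J 0
  set p := genProd J 0 with hp
  have := h.1
  have ee (x) : e (e x) = -x := LinearMap.congr_fun (h.posGen_mul_self 0) x
  have ep (x) : e (p x) = -p (e x) := LinearMap.congr_fun (h.posGen_mul_genProd 0) x
  have pe (x) : p (e x) = negGen J 0 x := LinearMap.congr_fun (h.genProd_mul_posGen 0) x
  have hsymm := h.2.2.1
  have e_skew (x y) : B (e x) y = -B x (e y) := h.posGen_skew 0 x y
  have alt (x y) : B (e x) y = -B (e y) x := by rw [e_skew, hsymm]
  have iso {x y} (hx : p x = x) (hy : p y = y) : B x y = 0 := by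
    have := h.genProd_skew 0 x y
    rw [LinearMap.neg_apply, map_neg, ← hp, hx, hy] at this
    linarith
  have hvv : B (e v) v = 0 := by linarith [alt v v]
  have hww : B (e w) w = 0 := by linarith [alt w w]
  have hwv : B (e w) v = -1 := by rw [alt, hvw]
  have li : LinearIndependent ℝ ![v, w, e v, e w] := by
    rw [Fintype.linearIndependent_iff]
    intro c hc
    have hB (x) := congrArg (B x) hc
    simp only [Fin.sum_univ_four, map_add, map_smul, map_zero, Matrix.cons_val, smul_eq_mul] at hB
    have h0 := hB (e w)
    have h1 := hB (e v)
    have h2 := hB w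
    have h3 := hB v
    simp only [e_skew _ (e _), ee, map_neg, hvw, hwv, hvv, hww, iso hv hv, iso hv hw, iso hw hv,
      iso hw hw] at h0 h1
    simp only [hsymm v (e _), hsymm w (e _), hvw, hwv, hvv, hww, iso hv hv, iso hv hw, iso hw hv,
      iso hw hw] at h2 h3
    intro i
    fin_cases i <;> simp <;> linarith
  have key (x) : p x = (2 * B (e x) w) • v - (2 * B (e x) v) • w - x := by
    let b := basisOfLinearIndependentOfCardEqFinrank li
      (le_antisymm li.fintype_card_le_finrank (by simpa using hdim))
    let L : Module.End ℝ V := (2 : ℝ) • (B.flip w ∘ₗ e).smulRight v -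
      (2 : ℝ) • (B.flip v ∘ₗ e).smulRight w - LinearMap.id
    have hL (x) : L x = (2 * B (e x) w) • v - (2 * B (e x) v) • w - x := by
      simp [L, mul_smul]
    rw [← hL]
    refine LinearMap.congr_fun (b.ext fun i => ?_) x
    have pev : p (e v) = -e v := by rw [← neg_eq_iff_eq_neg, ← ep, hv]
    have pew : p (e w) = -e w := by rw [← neg_eq_iff_eq_neg, ← ep, hw]
    rw [coe_basisOfLinearIndependentOfCardEqFinrank, hL]
    fin_cases i
    · simp [hv, hvw, hvv, two_smul]
    · simp [hw, hww, hwv, two_smul]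
    · simp [pev, ee, iso hv hw, iso hv hv]
    · simp [pew, ee, iso hw hw, iso hw hv]
  have neg_eq (x y) : B (negGen J 0 x) y =
      B (e x) y - 2 * B (e x) w * B (e v) y + 2 * B (e x) v * B (e w) y := by
    rw [← pe, ← neg_eq_iff_eq_neg.2 (ep x), key]
    simp only [map_sub, map_smul, map_neg, LinearMap.sub_apply, LinearMap.smul_apply,
      LinearMap.neg_apply, smul_eq_mul]
    ring
  let A : Module.End ℝ V := LinearMap.id + (2 : ℝ) • (B.flip v ∘ₗ e).smulRight w
  have hA (x) : A x = x + (2 * B (e x) v) • w := by simp [A, mul_smul]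
  have hAA (x) : A (A x) = x := by
    simp only [hA, map_add, map_smul, LinearMap.add_apply, LinearMap.smul_apply, hwv, smul_eq_mul]
    module
  have hpos (x y) : B (e (A x)) (A y) = B (negGen J 0 x) y := by
    simp only [hA, neg_eq, map_add, map_smul, LinearMap.add_apply, LinearMap.smul_apply, hww,
      smul_eq_mul, alt v y]
    ring
  refine ⟨A, fun i x y => ?_, fun i x y => ?_⟩ <;> rw [Subsingleton.elim i 0, one_mul]
  · exact hpos x y
  · rw [← hpos, hAA, hAA]

end RankOne

theorem stmt9 (r : ℕ) (hr : r = 1 ∨ r = 2 ∨ r = 4)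
    (V1 : Type) [AddCommGroup V1] [Module ℝ V1]
    (B1 : V1 →ₗ[ℝ] V1 →ₗ[ℝ] ℝ)
    (J1 : (Fin (r + r) → ℝ) →ₗ[ℝ] V1 →ₗ[ℝ] V1)
    (br1 : V1 →ₗ[ℝ] V1 →ₗ[ℝ] (Fin (r + r) → ℝ))
    (hadm1 : IsMinimalAdmissible r r V1 B1 J1)
    (hbr1 : IsHBracket r r V1 B1 J1 br1)
    :
    ∃ (φ : (V1 × (Fin (r + r) → ℝ)) ≃ₗ[ℝ] (V1 × (Fin (r + r) → ℝ)))
      (C : (Fin (r + r) → ℝ) →ₗ[ℝ] (Fin (r + r) → ℝ)),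
      IsLieIso br1 br1 φ ∧
      (∀ Z : Fin (r + r) → ℝ, φ (0, Z) = (0, C Z)) ∧
      Function.Surjective ⇑C ∧
      (∀ Z W : Fin (r + r) → ℝ, sform r r (C Z) (C W) = -(sform r r Z W)) := by
  rcases hr with rfl | rfl | rfl
  · have hdim := hadm1.2 (Fin 4 → ℝ) modelForm modelAction isAdmissible_model
    rw [Module.finrank_fin_fun] at hdim
    obtain ⟨A, hpos, hneg⟩ := exists_exchange_one hadm1.1 hdim
    exact exists_antiisometric_automorphism one_ne_zero hadm1.1 hbr1 A (one_mul 1) hpos hneg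
  · obtain ⟨A, hpos, hneg⟩ := exists_exchange_two hadm1.1
    exact exists_antiisometric_automorphism two_ne_zero hadm1.1 hbr1 A (by norm_num) hpos hneg
  · obtain ⟨A, hpos, hneg⟩ := exists_exchange_four hadm1.1
    exact exists_antiisometric_automorphism four_ne_zero hadm1.1 hbr1 A (one_mul 1) hpos hneg
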